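/- arXiv:2012.14079 — 2 statements merged into one kernel-verified Lean document; each statement's English description precedes it below -/
import Mathlib

section
/- Let T1 and T2 be path covers of G with T1 \ T2 = {e1} and T2 \ T1 = {e2}, where e1 = (p1, p2), e2 = (p3, p4), p1 ∉ {p3, p4} and p4 ∉ {p1, p2} (the case p2 = p3 is allowed). Suppose 𝒫(T1 ∩ T2) contains a path P having p2 as an endpoint such that P ∪ {e1} and P ∪ {e2} are both paths, and that P is a (p2, p3)-path in case p2 ≠ p3. Then there exist edge sets B1, B2 ⊆ E with B1 ∩ B2 = ∅ such that: (i) T_i ∪ B_i is a tour of G for i = 1,2; (ii) V(B_i) = V1(T_i) for i = 1,2; and (iii) B1 ∪ B2 consists of a (p1, p4)-path if p2 = p3, and, if p2 ≠ p3, of either vertex-disjoint (p1, p2)- and (p3, p4)-paths or vertex-disjoint (p1, p3)- and (p2, p4)-paths. -/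
variable {V : Type*} [Fintype V] [DecidableEq V]

/-- The degree of vertex `v` in the edge set `F`. -/
def degE (F : Finset (Sym2 V)) (v : V) : ℕ := (F.filter (fun e => v ∈ e)).card

/-- The set of vertices incident to an edge of `F`. -/
def VsetE (F : Finset (Sym2 V)) : Set V := {v | ∃ e ∈ F, v ∈ e}

/-- Vertices incident to exactly one edge of `F`. -/
def V1E (F : Finset (Sym2 V)) : Set V := {v | degE F v = 1}

/-- Vertices incident to exactly two edges of `F`. -/
def V2E (F : Finset (Sym2 V)) : Set V := {v | degE F v = 2}

/-- All edges are genuine edges of the complete graph (no loops). -/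
def SimpleE (F : Finset (Sym2 V)) : Prop := ∀ e ∈ F, ¬ e.IsDiag

/-- `F` is spanning: every vertex is incident to an edge of `F`. -/
def SpanningE (F : Finset (Sym2 V)) : Prop := VsetE F = Set.univ

/-- `F` is a `k`-matching: every vertex has at most `k` incident edges. -/
def IsKMatching (k : ℕ) (F : Finset (Sym2 V)) : Prop :=
  SimpleE F ∧ ∀ v : V, degE F v ≤ k

/-- `F` is a `k`-factor: every vertex has exactly `k` incident edges. -/
def IsKFactor (k : ℕ) (F : Finset (Sym2 V)) : Prop :=
  SimpleE F ∧ ∀ v : V, degE F v = k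

/-- `F` is the edge set of a single (simple) cycle. -/
def IsCycleE (F : Finset (Sym2 V)) : Prop :=
  ∃ m : ℕ, 3 ≤ m ∧ ∃ f : ℕ → V,
    (∀ i < m, ∀ j < m, f i = f j → i = j) ∧
    F = (Finset.range m).image (fun i => s(f i, f ((i + 1) % m)))

/-- `F` contains no cycle. -/
def AcyclicE (F : Finset (Sym2 V)) : Prop :=
  ∀ C : Finset (Sym2 V), C ⊆ F → ¬ IsCycleE C

/-- `F` is the edge set of a simple path with endpoints `a` and `b`. -/
def IsPathE (F : Finset (Sym2 V)) (a b : V) : Prop :=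
  ∃ m : ℕ, 1 ≤ m ∧ ∃ f : ℕ → V,
    (∀ i ≤ m, ∀ j ≤ m, f i = f j → i = j) ∧ f 0 = a ∧ f m = b ∧
    F = (Finset.range m).image (fun i => s(f i, f (i + 1)))

/-- `P` is a maximal path of `F`, i.e. `P ∈ 𝒫(F)`. -/
def MaxPathE (F P : Finset (Sym2 V)) : Prop :=
  P ⊆ F ∧ (∃ a b : V, IsPathE P a b) ∧
  ∀ e ∈ F, (∃ v : V, v ∈ e ∧ v ∈ VsetE P) → e ∈ P

/-- `F` is a path cover: a spanning acyclic 2-matching. -/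
def IsPathCoverE (F : Finset (Sym2 V)) : Prop :=
  IsKMatching 2 F ∧ SpanningE F ∧ AcyclicE F

/-- `F` is a tour: the edge set of a Hamiltonian cycle. -/
def IsTourE (F : Finset (Sym2 V)) : Prop :=
  IsCycleE F ∧ SpanningE F

/-- Total length of the edge set `F`. -/
def lenE (ℓ : Sym2 V → ℝ) (F : Finset (Sym2 V)) : ℝ := ∑ e ∈ F, ℓ e

/-- Minimum length of a tour. -/
noncomputable def optE (ℓ : Sym2 V → ℝ) : ℝ :=
  sInf {x | ∃ H : Finset (Sym2 V), IsTourE H ∧ lenE ℓ H = x}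

/-- Maximum length of a tour. -/
noncomputable def worE (ℓ : Sym2 V → ℝ) : ℝ :=
  sSup {x | ∃ H : Finset (Sym2 V), IsTourE H ∧ lenE ℓ H = x}

/-- The set of edges of `F` incident to `v`. -/
def deltaE (F : Finset (Sym2 V)) (v : V) : Finset (Sym2 V) :=
  F.filter (fun e => v ∈ e)

/-- `(S, T)` is a valid pair of spanning 2-matchings. -/
def ValidPairE (S T : Finset (Sym2 V)) : Prop :=
  IsKMatching 2 S ∧ IsKMatching 2 T ∧ SpanningE S ∧ SpanningE T ∧
  AcyclicE T ∧
  (∀ v : V, v ∈ V2E S → v ∈ V2E T → deltaE S v = deltaE T v) ∧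
  (∀ C : Finset (Sym2 V), C ⊆ S → IsCycleE C →
    ∀ P : Finset (Sym2 V), MaxPathE T P → VsetE C ≠ VsetE P)


set_option linter.unusedSectionVars false

/-! ### Vertex sets and degrees -/

theorem VsetE_union (F H : Finset (Sym2 V)) : VsetE (F ∪ H) = VsetE F ∪ VsetE H := by
  ext v
  simp only [VsetE, Set.mem_ofPred_eq, Finset.mem_union, Set.mem_union]
  grind

theorem VsetE_insert (a b : V) (F : Finset (Sym2 V)) :
    VsetE (insert s(a, b) F) = insert a (insert b (VsetE F)) := by
  ext v
  simp [VsetE, or_assoc]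

theorem VsetE_singleton (a b : V) : VsetE {s(a, b)} = {a, b} := by
  ext v
  simp [VsetE]

theorem VsetE_mono {F H : Finset (Sym2 V)} (h : F ⊆ H) : VsetE F ⊆ VsetE H :=
  fun _ ⟨e, he, hv⟩ => ⟨e, h he, hv⟩

theorem left_mem_VsetE {a b : V} {F : Finset (Sym2 V)} (h : s(a, b) ∈ F) : a ∈ VsetE F :=
  ⟨_, h, Sym2.mem_mk_left a b⟩

theorem right_mem_VsetE {a b : V} {F : Finset (Sym2 V)} (h : s(a, b) ∈ F) : b ∈ VsetE F :=
  ⟨_, h, Sym2.mem_mk_right a b⟩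

theorem degE_insert {e : Sym2 V} {F : Finset (Sym2 V)} (h : e ∉ F) (v : V) :
    degE (insert e F) v = degE F v + if v ∈ e then 1 else 0 := by
  unfold degE
  rw [Finset.filter_insert]
  split_ifs
  · rw [Finset.card_insert_of_notMem (by simp [h])]
  · rfl

theorem degE_union {F H : Finset (Sym2 V)} (h : Disjoint F H) (v : V) :
    degE (F ∪ H) v = degE F v + degE H v := by
  unfold degE
  rw [Finset.filter_union, Finset.card_union_of_disjoint (Finset.disjoint_filter_filter h)]

theorem degE_mono {F H : Finset (Sym2 V)} (h : F ⊆ H) (v : V) : degE F v ≤ degE H v :=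
  Finset.card_le_card (Finset.filter_subset_filter _ h)

theorem degE_pos_iff {F : Finset (Sym2 V)} {v : V} : 0 < degE F v ↔ v ∈ VsetE F := by
  simp [degE, VsetE, Finset.card_pos, Finset.Nonempty]

theorem image_range_succ_eq_insert {α : Type*} [DecidableEq α] (g : ℕ → α) (m : ℕ) :
    (Finset.range (m + 1)).image g =
      insert (g 0) ((Finset.range m).image fun i => g (i + 1)) := by
  rw [Finset.range_add_one', Finset.image_insert, Finset.map_eq_image, Finset.image_image]
  rfl

/-! ### Paths as an inductive predicate -/

/-- `F` is the edge set of a simple path from `a` to `b`, built edge by edge. -/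
inductive EdgePath : Finset (Sym2 V) → V → V → Prop
  | single {a b : V} (h : a ≠ b) : EdgePath {s(a, b)} a b
  | cons {a b c : V} {F : Finset (Sym2 V)} (h : a ∉ VsetE F) (p : EdgePath F b c) :
      EdgePath (insert s(a, b) F) a c

namespace EdgePath

variable {F A B C : Finset (Sym2 V)} {a a' b b' c c' u v x : V}

theorem left_mem (p : EdgePath F a b) : a ∈ VsetE F := by
  cases p <;> simp [VsetE_insert, VsetE_singleton]

theorem right_mem (p : EdgePath F a b) : b ∈ VsetE F := by
  induction p with
  | single => simp [VsetE_singleton]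
  | cons h p ih => simp [VsetE_insert, ih]

theorem ne (p : EdgePath F a b) : a ≠ b := by
  cases p with
  | single h => exact h
  | cons h p => rintro rfl; exact h p.right_mem

theorem ne_of_mem (p : EdgePath F a b) (h : s(u, v) ∈ F) : u ≠ v := by
  induction p with
  | single hab =>
    rintro rfl
    simp only [Finset.mem_singleton, Sym2.eq_iff] at h
    grind
  | cons ha p ih =>
    rcases Finset.mem_insert.1 h with h | h
    · have := p.left_mem
      rintro rfl
      simp only [Sym2.eq_iff] at h
      grind
    · exact ih h

theorem append (p : EdgePath A a b) (q : EdgePath B b c)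
    (h : ∀ x ∈ VsetE A, x ∈ VsetE B → x = b) : EdgePath (A ∪ B) a c := by
  induction p with
  | single hab =>
    rw [← Finset.insert_eq]
    exact cons (fun ha => hab (h _ (by simp [VsetE_singleton]) ha)) q
  | @cons a d b F ha p ih =>
    rw [Finset.insert_union]
    refine cons ?_ (ih q fun x hx => h x (by simp [VsetE_insert, hx]))
    rw [VsetE_union]
    rintro (h' | h')
    · exact ha h'
    · obtain rfl := h a (by simp [VsetE_insert]) h'
      exact ha p.right_mem

theorem symm (p : EdgePath F a b) : EdgePath F b a := by
  induction p with
  | single h => rw [Sym2.eq_swap]; exact single h.symm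
  | @cons a d b F ha p ih =>
    have hda : d ≠ a := fun h => ha (h ▸ p.left_mem)
    have := ih.append (single hda) (by
      simp only [VsetE_singleton]
      rintro x hx (rfl | rfl)
      · rfl
      · exact absurd hx ha)
    rwa [Finset.union_comm, Sym2.eq_swap, ← Finset.insert_eq] at this

theorem link (p : EdgePath A a a') (q : EdgePath B b b') (h : Disjoint (VsetE A) (VsetE B)) :
    EdgePath (insert s(a', b) (A ∪ B)) a b' := by
  have h' := Set.disjoint_left.1 h
  have := p.append (cons (h' p.right_mem) q) (by
    rw [VsetE_insert]
    rintro x hx (rfl | rfl | hx')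
    · rfl
    · exact absurd q.left_mem (h' hx)
    · exact absurd hx' (h' hx))
  rwa [Finset.union_insert] at this

theorem replace {R : Finset (Sym2 V)} (p : EdgePath A a b) (q : EdgePath R u v)
    (he : s(u, v) ∈ A) (h : ∀ x ∈ VsetE R, x ∈ VsetE A → x = u ∨ x = v) :
    EdgePath (A.erase s(u, v) ∪ R) a b := by
  induction p with
  | @single a b hab =>
    have he' : s(u, v) = s(a, b) := by simpa using he
    rw [he', Finset.erase_singleton, Finset.empty_union]
    rcases Sym2.eq_iff.1 he' with ⟨rfl, rfl⟩ | ⟨rfl, rfl⟩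
    exacts [q, q.symm]
  | @cons a d b F ha p ih =>
    have haF : s(a, d) ∉ F := fun h => ha (left_mem_VsetE h)
    by_cases he' : s(u, v) = s(a, d)
    · have hF : ∀ x ∈ VsetE R, x ∈ VsetE F → x = d := fun x hx hx' => by
        have := h x hx (by simp [VsetE_insert, hx'])
        rcases Sym2.eq_iff.1 he' with ⟨rfl, rfl⟩ | ⟨rfl, rfl⟩ <;> rcases this with rfl | rfl <;>
          first | rfl | exact absurd hx' ha
      rw [he', Finset.erase_insert haF, Finset.union_comm]
      rcases Sym2.eq_iff.1 he' with ⟨rfl, rfl⟩ | ⟨rfl, rfl⟩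
      exacts [q.append p hF, q.symm.append p hF]
    · have heF : s(u, v) ∈ F := Finset.mem_of_mem_insert_of_ne he he'
      rw [Finset.erase_insert_of_ne (Ne.symm he'), Finset.insert_union]
      refine cons ?_ (ih heF fun x hx hx' => h x hx (by simp [VsetE_insert, hx']))
      rw [VsetE_union]
      rintro (h' | h')
      · exact ha (VsetE_mono (Finset.erase_subset _ _) h')
      · rcases h a h' (by simp [VsetE_insert]) with rfl | rfl
        exacts [ha (left_mem_VsetE heF), ha (right_mem_VsetE heF)]

theorem subdivide (p : EdgePath A a b) (he : s(u, v) ∈ A) (hx : x ∉ VsetE A) :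
    EdgePath (A.erase s(u, v) ∪ {s(u, x), s(x, v)}) a b := by
  have hxv : x ≠ v := fun h => hx (h ▸ right_mem_VsetE he)
  have hux : u ≠ x := fun h => hx (h ▸ left_mem_VsetE he)
  refine p.replace (cons ?_ (single hxv)) he ?_
  · simp [VsetE_singleton, hux, p.ne_of_mem he]
  · simp only [VsetE_insert, VsetE_singleton]
    rintro y (rfl | rfl | rfl | rfl) hy <;> simp_all

theorem degE_eq (p : EdgePath F a b) :
    degE F a = 1 ∧ degE F b = 1 ∧ ∀ v ∈ VsetE F, v ≠ a → v ≠ b → degE F v = 2 := by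
  induction p with
  | @single a b hab =>
    simp only [VsetE_singleton]
    refine ⟨?_, ?_, ?_⟩
    · simp [degE, Finset.filter_singleton]
    · simp [degE, Finset.filter_singleton]
    · rintro v (rfl | rfl) <;> simp
  | @cons a d b F ha p ih =>
    obtain ⟨hd, hb, hi⟩ := ih
    have haF : s(a, d) ∉ F := fun h => ha (left_mem_VsetE h)
    have ha0 : degE F a = 0 := by
      by_contra h; exact ha (degE_pos_iff.1 (Nat.pos_of_ne_zero h))
    simp only [degE_insert haF, VsetE_insert, Sym2.mem_iff]
    have hba : b ≠ a := fun h => ha (h ▸ p.right_mem)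
    have hbd := p.ne
    refine ⟨by simp [ha0], by simp [hb, hba, hbd.symm], ?_⟩
    rintro v (rfl | rfl | hv) hva hvb
    · exact absurd rfl hva
    · simp [hd]
    · by_cases hvd : v = d
      · subst hvd; simp [hd]
      · simp [hva, hvd, hi v hv hvd hvb]

theorem eq_or_eq_of_degE_le_one (p : EdgePath F a b) (hv : v ∈ VsetE F) (h : degE F v ≤ 1) :
    v = a ∨ v = b := by
  by_contra! hc
  have := p.degE_eq.2.2 v hv hc.1 hc.2
  omega

theorem subset_of_closed {U : Finset (Sym2 V)} (p : EdgePath F a b)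
    (hU : ∀ e ∈ F, (∃ v, v ∈ e ∧ v ∈ VsetE U) → e ∈ U) (hv : v ∈ VsetE F)
    (hv' : v ∈ VsetE U) : F ⊆ U := by
  induction p generalizing v with
  | @single a b hab =>
    obtain ⟨e, he, hve⟩ := hv
    rw [Finset.mem_singleton] at he
    subst he
    simpa using hU _ (by simp) ⟨v, hve, hv'⟩
  | @cons a d b F ha p ih =>
    have key : s(a, d) ∈ U ∧ d ∈ VsetE U → insert s(a, d) F ⊆ U := fun h =>
      Finset.insert_subset h.1
        (ih (fun e he => hU e (Finset.mem_insert_of_mem he)) p.left_mem h.2)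
    have key' : s(a, d) ∈ U → insert s(a, d) F ⊆ U := fun h => key ⟨h, right_mem_VsetE h⟩
    rw [VsetE_insert] at hv
    rcases hv with rfl | rfl | hv
    · exact key' (hU _ (by simp) ⟨v, by simp, hv'⟩)
    · exact key' (hU _ (by simp) ⟨v, by simp, hv'⟩)
    · have hFU := ih (fun e he => hU e (Finset.mem_insert_of_mem he)) hv hv'
      exact key' (hU _ (by simp) ⟨d, by simp, VsetE_mono hFU p.left_mem⟩)

theorem isPathE (p : EdgePath F a b) : IsPathE F a b := by
  induction p with
  | @single a b hab =>
    refine ⟨1, le_rfl, fun i => if i = 0 then a else b, ?_, by simp, by simp, by simp⟩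
    intro i hi j hj
    interval_cases i <;> interval_cases j <;> simp [hab, hab.symm]
  | @cons a d b F ha p ih =>
    obtain ⟨m, hm, f, hf, hf0, hfm, hF⟩ := ih
    have hne : ∀ i ≤ m, a ≠ f i := by
      rintro i hi rfl
      apply ha
      rw [hF]
      rcases Nat.lt_or_ge i m with h | h
      · exact ⟨s(f i, f (i + 1)), Finset.mem_image_of_mem _ (by simpa using h), by simp⟩
      · obtain rfl : i = m := le_antisymm hi h
        obtain ⟨k, rfl⟩ : ∃ k, i = k + 1 := ⟨i - 1, by omega⟩
        exact ⟨s(f k, f (k + 1)), Finset.mem_image_of_mem _ (by simp), by simp⟩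
    refine ⟨m + 1, by omega, fun i => Nat.casesOn i a f, ?_, rfl, hfm, ?_⟩
    · rintro (_ | i) hi (_ | j) hj h
      · rfl
      · exact absurd h (hne j (by omega))
      · exact absurd h.symm (hne i (by omega))
      · rw [hf i (by omega) j (by omega) h]
    · rw [image_range_succ_eq_insert, hF]
      simp [hf0]

theorem of_isPathE (h : IsPathE F a b) : EdgePath F a b := by
  obtain ⟨m, hm, f, hf, rfl, rfl, rfl⟩ := h
  induction m, hm using Nat.le_induction generalizing f with
  | base =>
    simp only [Finset.range_one, Finset.image_singleton]
    exact single fun h => by simpa using hf 0 (by omega) 1 (by omega) h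
  | succ m hm ih =>
    have := ih (fun i => f (i + 1)) fun i hi j hj h => by
      simpa using hf (i + 1) (by omega) (j + 1) (by omega) h
    rw [image_range_succ_eq_insert]
    refine cons ?_ this
    rintro ⟨e, he, h0⟩
    obtain ⟨i, hi, rfl⟩ := Finset.mem_image.1 he
    rw [Finset.mem_range] at hi
    rcases Sym2.mem_iff.1 h0 with h | h
    · exact absurd (hf _ (by omega) _ (by omega) h) (by omega)
    · exact absurd (hf _ (by omega) _ (by omega) h) (by omega)

end EdgePath

/-! ### Cycles as closed paths -/

/-- `C` is the edge set of a cycle, presented as a path together with a closing edge. -/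
def EdgeCycle (C : Finset (Sym2 V)) : Prop :=
  ∃ a b W, EdgePath W a b ∧ s(a, b) ∉ W ∧ C = insert s(a, b) W

namespace EdgeCycle

variable {C : Finset (Sym2 V)}

theorem ne_of_mem {u v : V} (h : EdgeCycle C) (he : s(u, v) ∈ C) : u ≠ v := by
  obtain ⟨a, b, W, p, -, rfl⟩ := h
  rcases Finset.mem_insert.1 he with he | he
  · have := p.ne
    rcases Sym2.eq_iff.1 he with ⟨rfl, rfl⟩ | ⟨rfl, rfl⟩
    exacts [this, this.symm]
  · exact p.ne_of_mem he

theorem isCycleE (h : EdgeCycle C) : IsCycleE C := by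
  obtain ⟨a, b, W, p, hab, rfl⟩ := h
  obtain ⟨m, hm, f, hf, rfl, rfl, rfl⟩ := p.isPathE
  have hm1 : m ≠ 1 := by rintro rfl; simp at hab
  refine ⟨m + 1, by omega, f, fun i hi j hj => hf i (by omega) j (by omega), ?_⟩
  rw [Finset.range_add_one, Finset.image_insert, Nat.mod_self, Sym2.eq_swap]
  congr 1
  refine Finset.image_congr fun i hi => ?_
  simp only [Finset.coe_range, Set.mem_Iio] at hi
  simp only [Nat.mod_eq_of_lt (show i + 1 < m + 1 by omega)]

theorem degE_eq (h : EdgeCycle C) {v : V} (hv : v ∈ VsetE C) : degE C v = 2 := by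
  obtain ⟨a, b, W, p, hab, rfl⟩ := h
  obtain ⟨ha, hb, hi⟩ := p.degE_eq
  rw [degE_insert hab]
  by_cases hva : v = a
  · simp [hva, ha]
  by_cases hvb : v = b
  · simp [hvb, hb]
  rw [hi v (by simpa [VsetE_insert, hva, hvb] using hv) hva hvb]
  simp [hva, hvb]

theorem of_two_paths {A B : Finset (Sym2 V)} {a a' b b' : V} (p : EdgePath A a a')
    (q : EdgePath B b b') (h : Disjoint (VsetE A) (VsetE B)) :
    EdgeCycle (insert s(a', b) (insert s(b', a) (A ∪ B))) := by
  have h' := Set.disjoint_left.1 h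
  refine ⟨a, b', _, p.link q h, ?_, ?_⟩
  · simp only [Finset.mem_insert, Finset.mem_union, not_or]
    refine ⟨?_, fun h => h' (right_mem_VsetE h) q.right_mem, fun h => h' p.left_mem (left_mem_VsetE h)⟩
    intro h
    rcases Sym2.eq_iff.1 h with ⟨h, -⟩ | ⟨h, -⟩
    · exact p.ne h
    · exact h' p.left_mem (h ▸ q.left_mem)
  · rw [Finset.insert_comm, Sym2.eq_swap (a := b')]

theorem of_three_paths {A B D : Finset (Sym2 V)} {a a' b b' d d' : V} (p : EdgePath A a a')
    (q : EdgePath B b b') (r : EdgePath D d d') (hAB : Disjoint (VsetE A) (VsetE B))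
    (hAD : Disjoint (VsetE A) (VsetE D)) (hBD : Disjoint (VsetE B) (VsetE D)) :
    EdgeCycle (insert s(a', b) (insert s(b', d) (insert s(d', a) (A ∪ B ∪ D)))) := by
  have := of_two_paths (p.link q hAB) r (by
    simp only [VsetE_insert, VsetE_union, Set.disjoint_insert_left, Set.disjoint_union_left]
    exact ⟨Set.disjoint_left.1 hAD p.right_mem, Set.disjoint_left.1 hBD q.left_mem, hAD, hBD⟩)
  convert this using 1
  ext e
  simp only [Finset.mem_insert, Finset.mem_union]
  tauto

theorem insert_path {R : Finset (Sym2 V)} {a b u v : V} (h : EdgeCycle C) (he : s(u, v) ∈ C)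
    (r : EdgePath R a b) (hR : Disjoint (VsetE R) (VsetE C)) :
    EdgeCycle (C.erase s(u, v) ∪ insert s(u, a) (insert s(b, v) R)) := by
  have hR' := Set.disjoint_left.1 hR
  have huC := left_mem_VsetE he
  have hvC := right_mem_VsetE he
  obtain ⟨s, t, W, p, hst, rfl⟩ := h
  have hWC : VsetE W ⊆ VsetE (insert s(s, t) W) := VsetE_mono (Finset.subset_insert _ _)
  have hRW : Disjoint (VsetE R) (VsetE W) := hR.mono_right hWC
  by_cases he' : s(u, v) = s(s, t)
  · rw [he', Finset.erase_insert hst]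
    rcases Sym2.eq_iff.1 he' with ⟨rfl, rfl⟩ | ⟨rfl, rfl⟩
    · convert of_two_paths r p.symm hRW using 1
      ext e
      simp only [Finset.mem_insert, Finset.mem_union]
      tauto
    · convert of_two_paths r p hRW using 1
      ext e
      simp only [Finset.mem_insert, Finset.mem_union]
      tauto
  · have heW : s(u, v) ∈ W := Finset.mem_of_mem_insert_of_ne he he'
    have huR : u ∉ VsetE R := fun h => hR' h huC
    have hvR : v ∉ VsetE R := fun h => hR' h hvC
    have huv : u ≠ v := p.ne_of_mem heW
    have q : EdgePath (insert s(u, a) (insert s(b, v) R)) u v := by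
      have := r.symm.cons hvR
      rw [Sym2.eq_swap] at this
      refine EdgePath.cons ?_ this.symm
      simp only [VsetE_insert, Set.mem_insert_iff, not_or]
      exact ⟨fun h => huR (h ▸ r.right_mem), huv, huR⟩
    refine ⟨s, t, _, p.replace q heW ?_, ?_, ?_⟩
    · simp only [VsetE_insert]
      rintro x (rfl | rfl | rfl | rfl | hx) hxW
      · exact Or.inl rfl
      · exact absurd (hWC hxW) (hR' r.left_mem)
      · exact absurd (hWC hxW) (hR' r.right_mem)
      · exact Or.inr rfl
      · exact absurd (hWC hxW) (hR' hx)
    · have hs : s ∉ VsetE R := fun h => hR' h (hWC p.left_mem)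
      have ht : t ∉ VsetE R := fun h => hR' h (hWC p.right_mem)
      simp only [Finset.mem_union, Finset.mem_erase, Finset.mem_insert, not_or, not_and]
      refine ⟨fun _ => hst, fun h => ?_, fun h => ?_, fun h => hs (left_mem_VsetE h)⟩
      · rcases Sym2.eq_iff.1 h with ⟨-, h⟩ | ⟨h, -⟩
        exacts [ht (h ▸ r.left_mem), hs (h ▸ r.left_mem)]
      · rcases Sym2.eq_iff.1 h with ⟨h, -⟩ | ⟨-, h⟩
        exacts [hs (h ▸ r.right_mem), ht (h ▸ r.right_mem)]
    · rw [Finset.erase_insert_of_ne (Ne.symm he'), Finset.insert_union]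

end EdgeCycle

/-! ### Components of acyclic 2-matchings -/

/-- `W` is a union of connected components of `F`. -/
def ClosedIn (F W : Finset (Sym2 V)) : Prop :=
  W ⊆ F ∧ ∀ e ∈ F, (∃ v, v ∈ e ∧ v ∈ VsetE W) → e ∈ W

theorem ClosedIn.union {F W X : Finset (Sym2 V)} (hW : ClosedIn F W) (hX : ClosedIn F X) :
    ClosedIn F (W ∪ X) := by
  refine ⟨Finset.union_subset hW.1 hX.1, fun e he ⟨v, hve, hv⟩ => ?_⟩
  rw [VsetE_union] at hv
  rcases hv with hv | hv
  · exact Finset.mem_union_left _ (hW.2 e he ⟨v, hve, hv⟩)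
  · exact Finset.mem_union_right _ (hX.2 e he ⟨v, hve, hv⟩)

theorem ClosedIn.disjoint_VsetE {F W X : Finset (Sym2 V)} {a b : V} {e : Sym2 V}
    (hW : ClosedIn F W) (hX : ClosedIn F X) (p : EdgePath X a b) (he : e ∈ X) (he' : e ∉ W) :
    Disjoint (VsetE X) (VsetE W) :=
  Set.disjoint_left.2 fun _ hvX hvW =>
    he' (p.subset_of_closed (fun e he => hW.2 e (hX.1 he)) hvX hvW he)

theorem AcyclicE.closing_edge_mem {F W : Finset (Sym2 V)} {a b : V} (hF : AcyclicE F)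
    (p : EdgePath W a b) (hWF : W ⊆ F) (h : s(a, b) ∈ F) : s(a, b) ∈ W := by
  by_contra hW
  exact hF _ (Finset.insert_subset h hWF) (EdgeCycle.isCycleE ⟨a, b, W, p, hW, rfl⟩)

/-- In an acyclic 2-matching every edge lies on a path that is a connected component. -/
theorem exists_path_component {F : Finset (Sym2 V)} (hF : IsKMatching 2 F) (hac : AcyclicE F)
    {e : Sym2 V} (he : e ∈ F) : ∃ W a b, EdgePath W a b ∧ e ∈ W ∧ ClosedIn F W := by
  classical
  let S := F.powerset.filter fun W => e ∈ W ∧ ∃ a b, EdgePath W a b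
  have hS : S.Nonempty := by
    refine ⟨{e}, ?_⟩
    induction e with | _ a b =>
    have hab : a ≠ b := fun h => hF.1 _ he (by simpa using h)
    simp only [S, Finset.mem_filter, Finset.mem_powerset, Finset.singleton_subset_iff]
    exact ⟨he, by simp, a, b, .single hab⟩
  obtain ⟨W, hW, hmax⟩ := S.exists_max_image Finset.card hS
  simp only [S, Finset.mem_filter, Finset.mem_powerset] at hW hmax
  obtain ⟨hWF, heW, a, b, p⟩ := hW
  have hend : ∀ {a b z : V}, EdgePath W a b → s(a, z) ∈ F → s(a, z) ∈ W := by
    intro a b z p hz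
    by_contra hzW
    have hza : z ≠ a := fun h => hF.1 _ hz (by simp [h])
    by_cases hzV : z ∈ VsetE W
    · by_cases hzb : z = b
      · exact hzW (hzb ▸ hac.closing_edge_mem p hWF (hzb ▸ hz))
      · have h1 := p.degE_eq.2.2 z hzV hza hzb
        have h2 := degE_mono (Finset.insert_subset hz hWF) z
        have h3 := hF.2 z
        rw [degE_insert hzW] at h2
        simp at h2
        omega
    · have := hmax (insert s(a, z) W) ⟨Finset.insert_subset hz hWF, by simp [heW], z, b, by
        rw [Sym2.eq_swap]; exact p.cons hzV⟩
      rw [Finset.card_insert_of_notMem hzW] at this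
      omega
  refine ⟨W, a, b, p, heW, hWF, ?_⟩
  rintro f hf ⟨v, hvf, hv⟩
  obtain ⟨z, rfl⟩ := hvf
  by_cases hva : v = a
  · subst hva; exact hend p hf
  by_cases hvb : v = b
  · subst hvb; exact hend p.symm hf
  by_contra hfW
  have h1 := p.degE_eq.2.2 v hv hva hvb
  have h2 := degE_mono (Finset.insert_subset hf hWF) v
  have h3 := hF.2 v
  rw [degE_insert hfW] at h2
  simp at h2
  omega

/-- A vertex of degree one is an endpoint of its component. -/
theorem exists_path_component_of_endpoint {F : Finset (Sym2 V)} (hF : IsKMatching 2 F)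
    (hac : AcyclicE F) {v : V} (hv : v ∈ VsetE F) (hdeg : degE F v ≤ 1) :
    ∃ W b, EdgePath W v b ∧ ClosedIn F W := by
  obtain ⟨e, he, hve⟩ := hv
  obtain ⟨W, a, b, p, heW, hW⟩ := exists_path_component hF hac he
  rcases p.eq_or_eq_of_degE_le_one ⟨e, heW, hve⟩ ((degE_mono hW.1 v).trans hdeg) with rfl | rfl
  exacts [⟨W, _, p, hW⟩, ⟨W, _, p.symm, hW⟩]

/-- Completing a path cover to a tour by disjoint edges uses exactly its endpoints. -/
theorem IsPathCoverE.isTourE_union {T B : Finset (Sym2 V)} (hT : IsPathCoverE T)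
    (hC : EdgeCycle (T ∪ B)) (hTB : Disjoint T B) :
    IsTourE (T ∪ B) ∧ VsetE B = V1E T := by
  have huniv : VsetE (T ∪ B) = Set.univ := by rw [VsetE_union, hT.2.1, Set.univ_union]
  refine ⟨⟨hC.isCycleE, huniv⟩, ?_⟩
  ext v
  have h1 := hC.degE_eq (v := v) (by simp [huniv])
  have h2 : 0 < degE T v := degE_pos_iff.2 (by rw [hT.2.1]; trivial)
  rw [degE_union hTB] at h1
  rw [← degE_pos_iff, V1E, Set.mem_ofPred_eq]
  omega

/-! ### Closing two families of paths simultaneously -/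

/-- `B₁` and `B₂` are disjoint and close `F + e₁` and `F + e₂`, respectively, to cycles on the
vertices of `F`. -/
structure ClosingPair (e₁ e₂ : Sym2 V) (F B₁ B₂ : Finset (Sym2 V)) : Prop where
  cycle_left : EdgeCycle (insert e₁ (F ∪ B₁))
  cycle_right : EdgeCycle (insert e₂ (F ∪ B₂))
  verts_left : VsetE (insert e₁ (F ∪ B₁)) ⊆ VsetE F
  verts_right : VsetE (insert e₂ (F ∪ B₂)) ⊆ VsetE F
  disjoint_left : Disjoint B₁ (insert e₁ F)
  disjoint_right : Disjoint B₂ (insert e₂ F)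
  disjoint : Disjoint B₁ B₂

theorem EdgeCycle.insert_path_of_closing {e : Sym2 V} {F B R : Finset (Sym2 V)} {a b u v : V}
    (hC : EdgeCycle (insert e (F ∪ B))) (hV : VsetE (insert e (F ∪ B)) ⊆ VsetE F)
    (hB : Disjoint B (insert e F)) (huv : s(u, v) ∈ B) (r : EdgePath R a b)
    (hR : Disjoint (VsetE R) (VsetE F)) :
    EdgeCycle (insert e (F ∪ R ∪ (B.erase s(u, v) ∪ {s(u, a), s(b, v)}))) ∧
    VsetE (insert e (F ∪ R ∪ (B.erase s(u, v) ∪ {s(u, a), s(b, v)}))) ⊆ VsetE (F ∪ R) ∧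
    Disjoint (B.erase s(u, v) ∪ {s(u, a), s(b, v)}) (insert e (F ∪ R)) := by
  have hmem : s(u, v) ∈ insert e (F ∪ B) := by simp [huv]
  have hu := hV (left_mem_VsetE hmem)
  have hv := hV (right_mem_VsetE hmem)
  have hR' := Set.disjoint_left.1 hR
  have huvF := Finset.disjoint_left.1 hB huv
  have heq : insert e (F ∪ R ∪ (B.erase s(u, v) ∪ {s(u, a), s(b, v)})) =
      (insert e (F ∪ B)).erase s(u, v) ∪ insert s(u, a) (insert s(b, v) R) := by
    ext f
    simp only [Finset.mem_insert, Finset.mem_union, Finset.mem_erase, Finset.mem_singleton,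
      not_or] at huvF ⊢
    grind
  refine ⟨?_, ?_, ?_⟩
  · rw [heq]
    exact hC.insert_path hmem r (hR.mono_right hV)
  · rw [heq, VsetE_union, VsetE_union, VsetE_insert, VsetE_insert]
    refine Set.union_subset
      (((VsetE_mono (Finset.erase_subset _ _)).trans hV).trans Set.subset_union_left) ?_
    have := r.left_mem
    have := r.right_mem
    rintro x (rfl | rfl | rfl | rfl | hx) <;> simp_all
  · have hcross : ∀ {x z : V}, x ∈ VsetE R → z ∈ VsetE F → s(x, z) ∉ insert e (F ∪ R) := by
      intro x z hx hz h
      rcases Finset.mem_insert.1 h with h | h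
      · exact hR' hx (hV (left_mem_VsetE (b := z) (by simp [h])))
      · rcases Finset.mem_union.1 h with h | h
        · exact hR' hx (left_mem_VsetE h)
        · exact hR' (right_mem_VsetE h) hz
    rw [Finset.disjoint_left]
    intro f hf
    simp only [Finset.mem_union, Finset.mem_insert, Finset.mem_singleton] at hf
    rcases hf with hf | rfl | rfl
    · have hfB := Finset.mem_of_mem_erase hf
      have := Finset.disjoint_left.1 hB hfB
      simp only [Finset.mem_insert, Finset.mem_union, not_or] at this ⊢
      refine ⟨this.1, this.2, fun hfR => ?_⟩
      induction f with | _ x z =>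
      exact hR' (left_mem_VsetE hfR)
        (hV (left_mem_VsetE (b := z) (Finset.mem_insert_of_mem (Finset.mem_union_right _ hfB))))
    · rw [Sym2.eq_swap]; exact hcross r.left_mem hu
    · exact hcross r.right_mem hv

theorem ClosingPair.insert_path {e₁ e₂ : Sym2 V} {F B₁ B₂ R : Finset (Sym2 V)}
    {a b u v x y : V} (h : ClosingPair e₁ e₂ F B₁ B₂) (huv : s(u, v) ∈ B₁) (hxy : s(x, y) ∈ B₂)
    (hux : u ≠ x) (hvy : v ≠ y) (r : EdgePath R a b) (hR : Disjoint (VsetE R) (VsetE F)) :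
    ClosingPair e₁ e₂ (F ∪ R) (B₁.erase s(u, v) ∪ {s(u, a), s(b, v)})
      (B₂.erase s(x, y) ∪ {s(x, a), s(b, y)}) := by
  obtain ⟨h1, h2, h3⟩ :=
    h.cycle_left.insert_path_of_closing h.verts_left h.disjoint_left huv r hR
  obtain ⟨h1', h2', h3'⟩ :=
    h.cycle_right.insert_path_of_closing h.verts_right h.disjoint_right hxy r hR
  refine ⟨h1, h1', h2, h2', h3, h3', ?_⟩
  have hB₁ : VsetE B₁ ⊆ VsetE F := (VsetE_mono (by grind)).trans h.verts_left
  have hB₂ : VsetE B₂ ⊆ VsetE F := (VsetE_mono (by grind)).trans h.verts_right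
  have hR' := Set.disjoint_left.1 hR
  have ha := hR' r.left_mem
  have hb := hR' r.right_mem
  have hab := r.ne
  have hu := hB₁ (left_mem_VsetE huv)
  have hv := hB₁ (right_mem_VsetE huv)
  have hx := hB₂ (left_mem_VsetE hxy)
  have hy := hB₂ (right_mem_VsetE hxy)
  have h1 : ∀ z, s(z, a) ∉ B₁ ∧ s(z, a) ∉ B₂ := fun z =>
    ⟨fun h => ha (hB₁ (right_mem_VsetE h)), fun h => ha (hB₂ (right_mem_VsetE h))⟩
  have h2 : ∀ z, s(b, z) ∉ B₁ ∧ s(b, z) ∉ B₂ := fun z =>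
    ⟨fun h => hb (hB₁ (left_mem_VsetE h)), fun h => hb (hB₂ (left_mem_VsetE h))⟩
  have e1 : s(u, a) ≠ s(x, a) := by rw [Ne, Sym2.eq_iff]; grind
  have e2 : s(u, a) ≠ s(b, y) := by rw [Ne, Sym2.eq_iff]; grind
  have e3 : s(b, v) ≠ s(x, a) := by rw [Ne, Sym2.eq_iff]; grind
  have e4 : s(b, v) ≠ s(b, y) := by rw [Ne, Sym2.eq_iff]; grind
  have hd := Finset.disjoint_left.1 h.disjoint
  rw [Finset.disjoint_left]
  simp only [Finset.mem_union, Finset.mem_erase, Finset.mem_insert, Finset.mem_singleton]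
  grind

/-- A closing pair on some components of `F` extends to all of `F`: a further component is inserted
at consecutive edges `uv` and `vy`, which subdivides both of them in `B₁ ∪ B₂`. -/
theorem ClosingPair.exists_full {e₁ e₂ : Sym2 V} {F F' B₁ B₂ : Finset (Sym2 V)} {u v y : V}
    {Shape : Finset (Sym2 V) → Prop}
    (hShape : ∀ W u v x, Shape W → s(u, v) ∈ W → x ∉ VsetE W →
      Shape (W.erase s(u, v) ∪ {s(u, x), s(x, v)}))
    (hF : IsKMatching 2 F) (hac : AcyclicE F) (hF' : ClosedIn F F')
    (h : ClosingPair e₁ e₂ F' B₁ B₂) (hB : Shape (B₁ ∪ B₂))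
    (huv : s(u, v) ∈ B₁) (hvy : s(v, y) ∈ B₂) :
    ∃ C₁ C₂, ClosingPair e₁ e₂ F C₁ C₂ ∧ Shape (C₁ ∪ C₂) := by
  induction hn : (F \ F').card using Nat.strong_induction_on
    generalizing F' B₁ B₂ u v y with | _ n ih =>
  by_cases hFF : F ⊆ F'
  · obtain rfl := hF'.1.antisymm hFF
    exact ⟨B₁, B₂, h, hB⟩
  obtain ⟨e, he, he'⟩ := Finset.not_subset.1 hFF
  obtain ⟨R, a, b, r, heR, hR⟩ := exists_path_component hF hac he
  have hdisj := hF'.disjoint_VsetE hR r heR he'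
  have huv' : s(u, v) ∈ insert e₁ (F' ∪ B₁) := by simp [huv]
  have hvy' : s(v, y) ∈ insert e₂ (F' ∪ B₂) := by simp [hvy]
  have hne₁ := h.cycle_left.ne_of_mem huv'
  have hne₂ := h.cycle_right.ne_of_mem hvy'
  have hnew := h.insert_path huv hvy hne₁ hne₂ r hdisj
  have hW : VsetE (B₁ ∪ B₂) ⊆ VsetE F' := by
    rw [VsetE_union]
    exact Set.union_subset
      ((VsetE_mono (Finset.subset_union_right.trans (Finset.subset_insert _ _))).trans h.verts_left)
      ((VsetE_mono (Finset.subset_union_right.trans (Finset.subset_insert _ _))).trans h.verts_right)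
  have hR' := Set.disjoint_left.1 hdisj
  have hu := h.verts_left (left_mem_VsetE huv')
  have hv := h.verts_left (right_mem_VsetE huv')
  have hy := h.verts_right (right_mem_VsetE hvy')
  have ha := hR' r.left_mem
  have hb := hR' r.right_mem
  have hd := Finset.disjoint_left.1 h.disjoint
  have hs₁ := hShape _ u v a hB (by simp [huv]) fun h => ha (hW h)
  have e1 : s(v, y) ≠ s(u, v) := fun h => hd huv (h ▸ hvy)
  have hs₂ := hShape _ v y b hs₁ (by simp [hvy, e1]) (by
    rw [VsetE_union, VsetE_insert, VsetE_singleton]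
    rintro (h | rfl | rfl | rfl | rfl)
    · exact hb (hW (VsetE_mono (Finset.erase_subset _ _) h))
    · exact hb hu
    · exact r.ne rfl
    · exact r.ne rfl
    · exact hb hv)
  have hsub : F \ (F' ∪ R) ⊆ F \ F' := Finset.sdiff_subset_sdiff le_rfl Finset.subset_union_left
  refine ih _ ?_ (hF'.union hR) hnew (u := u) (v := a) (y := v) ?_ (by simp)
    (by simp [Sym2.eq_swap]) rfl
  · rw [← hn]
    exact Finset.card_lt_card (Finset.ssubset_iff_of_subset hsub |>.2
      ⟨e, by simp [he, he'], by simp [heR]⟩)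
  · convert hs₂ using 1
    have e1 : s(v, y) ≠ s(u, a) := by rw [Ne, Sym2.eq_iff]; grind
    have e2 : s(v, y) ≠ s(a, v) := by rw [Ne, Sym2.eq_iff]; grind
    have e3 : s(v, a) = s(a, v) := Sym2.eq_swap
    have e4 : s(b, v) = s(v, b) := Sym2.eq_swap
    have h1 := hd huv
    have h2 : s(v, y) ∉ B₁ := fun h => hd h hvy
    rw [e3, e4]
    ext f
    simp only [Finset.mem_union, Finset.mem_erase, Finset.mem_insert, Finset.mem_singleton]
    grind

theorem ClosingPair.of_two_paths {P Q : Finset (Sym2 V)} {p₁ p₂ p₃ p₄ c q : V}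
    (hc : EdgePath P p₂ c) (hq : EdgePath P p₃ q) (h₁₄ : EdgePath Q p₁ p₄)
    (hPQ : Disjoint (VsetE P) (VsetE Q)) :
    ClosingPair s(p₁, p₂) s(p₃, p₄) (P ∪ Q) {s(c, p₄)} {s(q, p₁)} := by
  have hd := Set.disjoint_left.1 hPQ
  have m₁ := h₁₄.left_mem
  have m₄ := h₁₄.right_mem
  have m₂ := hc.left_mem
  have mc := hc.right_mem
  have m₃ := hq.left_mem
  have mq := hq.right_mem
  have n₁₄ := h₁₄.ne
  have n₂ := hc.ne
  have n₃ := hq.ne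
  refine ⟨?_, ?_, ?_, ?_, ?_, ?_, ?_⟩
  · convert EdgeCycle.of_two_paths hc h₁₄.symm hPQ using 1
    grind
  · convert EdgeCycle.of_two_paths hq h₁₄ hPQ using 1
    rw [Sym2.eq_swap (a := p₄)]
    grind
  · simp only [VsetE_insert, VsetE_union, VsetE_singleton]
    grind
  · simp only [VsetE_insert, VsetE_union, VsetE_singleton]
    grind
  · simp only [Finset.disjoint_singleton_left, Finset.mem_insert, Finset.mem_union, Sym2.eq_iff]
    grind [left_mem_VsetE, right_mem_VsetE]
  · simp only [Finset.disjoint_singleton_left, Finset.mem_insert, Finset.mem_union, Sym2.eq_iff]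
    grind [left_mem_VsetE, right_mem_VsetE]
  · simp only [Finset.disjoint_singleton_left, Finset.mem_singleton, Sym2.eq_iff]
    grind

theorem ClosingPair.of_three_paths {P Q R : Finset (Sym2 V)} {p₁ p₂ p₃ p₄ c q d₁ d₄ : V}
    (hc : EdgePath P p₂ c) (hq : EdgePath P p₃ q) (h₁ : EdgePath Q p₁ d₁)
    (h₄ : EdgePath R p₄ d₄) (hPQ : Disjoint (VsetE P) (VsetE Q))
    (hPR : Disjoint (VsetE P) (VsetE R)) (hQR : Disjoint (VsetE Q) (VsetE R)) :
    ClosingPair s(p₁, p₂) s(p₃, p₄) (P ∪ Q ∪ R) {s(d₁, p₄), s(d₄, c)} {s(d₁, q), s(d₄, p₁)} := by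
  have hdPQ := Set.disjoint_left.1 hPQ
  have hdPR := Set.disjoint_left.1 hPR
  have hdQR := Set.disjoint_left.1 hQR
  have m₁ := h₁.left_mem
  have md₁ := h₁.right_mem
  have m₄ := h₄.left_mem
  have md₄ := h₄.right_mem
  have m₂ := hc.left_mem
  have mc := hc.right_mem
  have m₃ := hq.left_mem
  have mq := hq.right_mem
  have n₁ := h₁.ne
  have n₄ := h₄.ne
  have n₂ := hc.ne
  have n₃ := hq.ne
  refine ⟨?_, ?_, ?_, ?_, ?_, ?_, ?_⟩
  · convert EdgeCycle.of_three_paths hc h₄.symm h₁.symm hPR hPQ hQR.symm using 1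
    rw [Sym2.eq_swap (a := p₄), Sym2.eq_swap (a := c)]
    ext e
    simp only [Finset.mem_insert, Finset.mem_union, Finset.mem_singleton]
    tauto
  · convert EdgeCycle.of_three_paths h₄ h₁ hq.symm hQR.symm hPR.symm hPQ.symm using 1
    ext e
    simp only [Finset.mem_insert, Finset.mem_union, Finset.mem_singleton]
    tauto
  · simp only [VsetE_insert, VsetE_union, VsetE_singleton]
    grind
  · simp only [VsetE_insert, VsetE_union, VsetE_singleton]
    grind
  · simp only [Finset.disjoint_insert_left, Finset.disjoint_singleton_left, Finset.mem_insert,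
      Finset.mem_union, Sym2.eq_iff]
    grind [left_mem_VsetE, right_mem_VsetE]
  · simp only [Finset.disjoint_insert_left, Finset.disjoint_singleton_left, Finset.mem_insert,
      Finset.mem_union, Sym2.eq_iff]
    grind [left_mem_VsetE, right_mem_VsetE]
  · simp only [Finset.disjoint_insert_left, Finset.disjoint_singleton_left, Finset.mem_insert,
      Finset.mem_singleton, Sym2.eq_iff]
    grind

/-! ### The shape of the union of the closing edges -/

/-- A path `a - x - c` of two edges. -/
theorem EdgePath.pair {a x c : V} (hax : a ≠ x) (hac : a ≠ c) (hxc : x ≠ c) :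
    EdgePath {s(a, x), s(x, c)} a c :=
  .cons (by simp [VsetE_singleton, hax, hac]) (.single hxc)

/-- A `(p₁, p₄)`-path if `p₂ = p₃`, and disjoint `(p₁, p₃)`- and `(p₂, p₄)`-paths otherwise. -/
def LinkShape (p₁ p₂ p₃ p₄ : V) (W : Finset (Sym2 V)) : Prop :=
  (p₂ = p₃ → EdgePath W p₁ p₄) ∧
  (p₂ ≠ p₃ → ∃ R₁ R₂, EdgePath R₁ p₁ p₃ ∧ EdgePath R₂ p₂ p₄ ∧
    Disjoint (VsetE R₁) (VsetE R₂) ∧ W = R₁ ∪ R₂)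

theorem disjoint_VsetE_subdivide {A B : Finset (Sym2 V)} {u v x : V}
    (h : Disjoint (VsetE A) (VsetE B)) (he : s(u, v) ∈ A) (hx : x ∉ VsetE B) :
    Disjoint (VsetE (A.erase s(u, v) ∪ {s(u, x), s(x, v)})) (VsetE B) := by
  have h' := Set.disjoint_left.1 h
  have hu := h' (left_mem_VsetE he)
  have hv := h' (right_mem_VsetE he)
  rw [VsetE_union, Set.disjoint_union_left]
  refine ⟨h.mono_left (VsetE_mono (Finset.erase_subset _ _)), ?_⟩
  simp [VsetE_insert, VsetE_singleton, hu, hv, hx]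

theorem LinkShape.subdivide {p₁ p₂ p₃ p₄ : V} (W : Finset (Sym2 V)) (u v x : V)
    (hW : LinkShape p₁ p₂ p₃ p₄ W) (he : s(u, v) ∈ W) (hx : x ∉ VsetE W) :
    LinkShape p₁ p₂ p₃ p₄ (W.erase s(u, v) ∪ {s(u, x), s(x, v)}) := by
  refine ⟨fun h => (hW.1 h).subdivide he hx, fun h => ?_⟩
  obtain ⟨R₁, R₂, r₁, r₂, hd, rfl⟩ := hW.2 h
  rw [VsetE_union, Set.mem_union, not_or] at hx
  rcases Finset.mem_union.1 he with he' | he'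
  · have hn : s(u, v) ∉ R₂ := fun h =>
      Set.disjoint_left.1 hd (left_mem_VsetE he') (left_mem_VsetE h)
    refine ⟨_, R₂, r₁.subdivide he' hx.1, r₂, disjoint_VsetE_subdivide hd he' hx.2, ?_⟩
    rw [Finset.erase_union_distrib, Finset.erase_eq_of_notMem hn, Finset.union_right_comm]
  · have hn : s(u, v) ∉ R₁ := fun h =>
      Set.disjoint_left.1 hd (left_mem_VsetE h) (left_mem_VsetE he')
    refine ⟨R₁, _, r₁, r₂.subdivide he' hx.2, (disjoint_VsetE_subdivide hd.symm he' hx.1).symm, ?_⟩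
    rw [Finset.erase_union_distrib, Finset.erase_eq_of_notMem hn, Finset.union_assoc]

theorem linkShape_of_swap {p₁ p₂ p₃ p₄ x y c q : V} (hcq : p₂ = p₃ → c = q)
    (hc : p₂ ≠ p₃ → c = p₃ ∧ q = p₂) (hn : [p₁, x, c, y, p₄].Nodup) (hn' : [p₁, x, q, y, p₄].Nodup) :
    LinkShape p₁ p₂ p₃ p₄ {s(p₁, x), s(x, c), s(q, y), s(y, p₄)} := by
  simp only [List.nodup_cons, List.mem_cons, List.not_mem_nil, or_false, not_or] at hn hn'
  refine ⟨fun h => ?_, fun h => ?_⟩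
  · obtain rfl := hcq h
    refine .cons ?_ (.cons ?_ (.pair ?_ ?_ ?_))
    case refine_1 | refine_2 =>
      simp only [VsetE_insert, VsetE_singleton, Set.mem_insert_iff, Set.mem_singleton_iff]
      grind
    all_goals grind
  · obtain ⟨rfl, rfl⟩ := hc h
    refine ⟨{s(p₁, x), s(x, c)}, {s(q, y), s(y, p₄)}, .pair ?_ ?_ ?_, .pair ?_ ?_ ?_, ?_, ?_⟩
    case refine_7 =>
      simp only [VsetE_insert, VsetE_singleton, Set.disjoint_left, Set.mem_insert_iff,
        Set.mem_singleton_iff]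
      grind
    all_goals grind

theorem stmt3 (T1 T2 P : Finset (Sym2 V)) (p1 p2 p3 p4 : V)
    (hT1 : IsPathCoverE T1) (hT2 : IsPathCoverE T2)
    (hd1 : T1 \ T2 = {s(p1, p2)}) (hd2 : T2 \ T1 = {s(p3, p4)})
    (hp1 : p1 ≠ p3 ∧ p1 ≠ p4) (hp4 : p4 ≠ p1 ∧ p4 ≠ p2)
    (hP : MaxPathE (T1 ∩ T2) P)
    (hPend : ∃ c : V, IsPathE P p2 c)
    (hPe1 : ∃ a b : V, IsPathE (insert (s(p1, p2)) P) a b)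
    (hPe2 : ∃ a b : V, IsPathE (insert (s(p3, p4)) P) a b)
    (hP23 : p2 ≠ p3 → IsPathE P p2 p3) :
    ∃ B1 B2 : Finset (Sym2 V),
      B1 ∩ B2 = ∅ ∧
      IsTourE (T1 ∪ B1) ∧ IsTourE (T2 ∪ B2) ∧
      VsetE B1 = V1E T1 ∧ VsetE B2 = V1E T2 ∧
      (p2 = p3 → IsPathE (B1 ∪ B2) p1 p4) ∧
      (p2 ≠ p3 →
        ((∃ R1 R2 : Finset (Sym2 V), IsPathE R1 p1 p2 ∧ IsPathE R2 p3 p4 ∧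
            Disjoint (VsetE R1) (VsetE R2) ∧ B1 ∪ B2 = R1 ∪ R2) ∨
         (∃ R1 R2 : Finset (Sym2 V), IsPathE R1 p1 p3 ∧ IsPathE R2 p2 p4 ∧
            Disjoint (VsetE R1) (VsetE R2) ∧ B1 ∪ B2 = R1 ∪ R2))) := by
  generalize hF : T1 ∩ T2 = F at hP
  have hFT₁ : F ⊆ T1 := hF ▸ Finset.inter_subset_left
  have hFT₂ : F ⊆ T2 := hF ▸ Finset.inter_subset_right
  have hT₁F : T1 = insert s(p1, p2) F := by
    rw [← hF, Finset.insert_eq, ← hd1, Finset.sdiff_union_inter]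
  have hT₂F : T2 = insert s(p3, p4) F := by
    rw [← hF, Finset.insert_eq, ← hd2, Finset.inter_comm, Finset.sdiff_union_inter]
  have he₁ : s(p1, p2) ∈ T1 ∧ s(p1, p2) ∉ T2 := by
    rw [← Finset.mem_sdiff, hd1]; simp
  have he₂ : s(p3, p4) ∈ T2 ∧ s(p3, p4) ∉ T1 := by
    rw [← Finset.mem_sdiff, hd2]; simp
  have he₁F : s(p1, p2) ∉ F := fun h => he₁.2 (hFT₂ h)
  have he₂F : s(p3, p4) ∉ F := fun h => he₂.2 (hFT₁ h)
  have hp₁₂ : p1 ≠ p2 := fun h => hT1.1.1 _ he₁.1 (by simpa using h)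
  have hp₃₄ : p3 ≠ p4 := fun h => hT2.1.1 _ he₂.1 (by simpa using h)
  have hFm : IsKMatching 2 F :=
    ⟨fun e he => hT1.1.1 e (hFT₁ he), fun v => (degE_mono hFT₁ v).trans (hT1.1.2 v)⟩
  have hFac : AcyclicE F := fun C hC => hT1.2.2 C (hC.trans hFT₁)
  have hdeg₁ : degE F p1 ≤ 1 := by
    have := hT1.1.2 p1
    rw [hT₁F, degE_insert he₁F] at this
    simpa using this
  have hdeg₄ : degE F p4 ≤ 1 := by
    have := hT2.1.2 p4
    rw [hT₂F, degE_insert he₂F] at this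
    simpa using this
  have hp₁F : p1 ∈ VsetE F := by
    have : p1 ∈ VsetE T2 := by rw [hT2.2.1]; trivial
    rw [hT₂F, VsetE_insert] at this
    simpa [hp1] using this
  have hp₄F : p4 ∈ VsetE F := by
    have : p4 ∈ VsetE T1 := by rw [hT1.2.1]; trivial
    rw [hT₁F, VsetE_insert] at this
    simpa [hp4] using this
  have hPc : ClosedIn F P := ⟨hP.1, hP.2.2⟩
  obtain ⟨c, q, hc, hq, hcq, hcq'⟩ : ∃ c q, EdgePath P p2 c ∧ EdgePath P p3 q ∧
      (p2 = p3 → c = q) ∧ (p2 ≠ p3 → c = p3 ∧ q = p2) := by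
    by_cases h : p2 = p3
    · subst h
      obtain ⟨c, hc⟩ := hPend
      exact ⟨c, c, .of_isPathE hc, .of_isPathE hc, by simp, by simp⟩
    · have := EdgePath.of_isPathE (hP23 h)
      exact ⟨p3, p2, this, this.symm, fun h' => absurd h' h, fun _ => ⟨rfl, rfl⟩⟩
  have hp₁P : p1 ∉ VsetE P := fun h => by
    rcases hc.eq_or_eq_of_degE_le_one h ((degE_mono hP.1 _).trans hdeg₁) with h | rfl
    · exact hp₁₂ h
    · have := hT1.2.2.closing_edge_mem hc (hP.1.trans hFT₁) (by rw [Sym2.eq_swap]; exact he₁.1)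
      rw [Sym2.eq_swap] at this
      exact he₁F (hP.1 this)
  have hp₄P : p4 ∉ VsetE P := fun h => by
    rcases hq.eq_or_eq_of_degE_le_one h ((degE_mono hP.1 _).trans hdeg₄) with h | rfl
    · exact hp₃₄ h.symm
    · exact he₂F (hP.1 (hT2.2.2.closing_edge_mem hq (hP.1.trans hFT₂) he₂.1))
  have htours : ∀ {B₁ B₂}, ClosingPair s(p1, p2) s(p3, p4) F B₁ B₂ →
      B₁ ∩ B₂ = ∅ ∧ IsTourE (T1 ∪ B₁) ∧ IsTourE (T2 ∪ B₂) ∧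
      VsetE B₁ = V1E T1 ∧ VsetE B₂ = V1E T2 := fun h => by
    obtain ⟨h₁, h₁'⟩ := hT1.isTourE_union
      (by rw [hT₁F, Finset.insert_union]; exact h.cycle_left) (hT₁F ▸ h.disjoint_left.symm)
    obtain ⟨h₂, h₂'⟩ := hT2.isTourE_union
      (by rw [hT₂F, Finset.insert_union]; exact h.cycle_right) (hT₂F ▸ h.disjoint_right.symm)
    exact ⟨Finset.disjoint_iff_inter_eq_empty.1 h.disjoint, h₁, h₂, h₁', h₂'⟩
  have hfull : ∀ {F' B₁ B₂ u v y}, ClosedIn F F' →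
      ClosingPair s(p1, p2) s(p3, p4) F' B₁ B₂ → LinkShape p1 p2 p3 p4 (B₁ ∪ B₂) →
      s(u, v) ∈ B₁ → s(v, y) ∈ B₂ → ∃ B₁ B₂ : Finset (Sym2 V), B₁ ∩ B₂ = ∅ ∧
      IsTourE (T1 ∪ B₁) ∧ IsTourE (T2 ∪ B₂) ∧ VsetE B₁ = V1E T1 ∧ VsetE B₂ = V1E T2 ∧
      (p2 = p3 → IsPathE (B₁ ∪ B₂) p1 p4) ∧
      (p2 ≠ p3 →
        ((∃ R1 R2 : Finset (Sym2 V), IsPathE R1 p1 p2 ∧ IsPathE R2 p3 p4 ∧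
            Disjoint (VsetE R1) (VsetE R2) ∧ B₁ ∪ B₂ = R1 ∪ R2) ∨
         (∃ R1 R2 : Finset (Sym2 V), IsPathE R1 p1 p3 ∧ IsPathE R2 p2 p4 ∧
            Disjoint (VsetE R1) (VsetE R2) ∧ B₁ ∪ B₂ = R1 ∪ R2))) := fun hF' h hS huv hvy => by
    obtain ⟨C₁, C₂, hC, hS⟩ := h.exists_full LinkShape.subdivide hFm hFac hF' hS huv hvy
    obtain ⟨h₁, h₂, h₃, h₄, h₅⟩ := htours hC
    refine ⟨C₁, C₂, h₁, h₂, h₃, h₄, h₅, fun h => (hS.1 h).isPathE, fun h => Or.inr ?_⟩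
    obtain ⟨R₁, R₂, r₁, r₂, h⟩ := hS.2 h
    exact ⟨R₁, R₂, r₁.isPathE, r₂.isPathE, h⟩
  obtain ⟨Q, d₁, hQ, hQc⟩ := exists_path_component_of_endpoint hFm hFac hp₁F hdeg₁
  have hPQ : Disjoint (VsetE P) (VsetE Q) := by
    obtain ⟨e, he, he'⟩ := hQ.left_mem
    exact (hPc.disjoint_VsetE hQc hQ he fun h => hp₁P ⟨e, h, he'⟩).symm
  have hdPQ := Set.disjoint_left.1 hPQ
  have mc := hc.right_mem
  have mq := hq.right_mem
  have m₁ := hQ.left_mem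
  have md₁ := hQ.right_mem
  have n₁ := hQ.ne
  by_cases hp₄Q : p4 ∈ VsetE Q
  · obtain rfl : p4 = d₁ :=
      (hQ.eq_or_eq_of_degE_le_one hp₄Q ((degE_mono hQc.1 _).trans hdeg₄)).resolve_left hp4.1
    have hpair := ClosingPair.of_two_paths hc hq hQ hPQ
    by_cases h₂₃ : p2 = p3
    · obtain rfl := hcq h₂₃
      refine hfull (hPc.union hQc) hpair ⟨fun _ => ?_, fun h => absurd h₂₃ h⟩
        (u := p4) (v := c) (y := p1) (by simp [Sym2.eq_swap]) (by simp)
      have : EdgePath {s(p1, c), s(c, p4)} p1 p4 := .pair (by grind) (by grind) (by grind)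
      rwa [Finset.pair_comm, Sym2.eq_swap (a := p1)] at this
    · obtain ⟨rfl, rfl⟩ := hcq' h₂₃
      by_cases hFPQ : F ⊆ P ∪ Q
      · obtain rfl := (hPc.union hQc).1.antisymm hFPQ
        obtain ⟨h₁, h₂, h₃, h₄, h₅⟩ := htours hpair
        refine ⟨_, _, h₁, h₂, h₃, h₄, h₅, fun h => absurd h h₂₃, fun _ => Or.inl
          ⟨{s(p1, q)}, {s(c, p4)}, (EdgePath.single hp₁₂).isPathE,
            (EdgePath.single hp₃₄).isPathE, ?_, ?_⟩⟩
        · simp only [VsetE_singleton, Set.disjoint_left, Set.mem_insert_iff,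
            Set.mem_singleton_iff]
          grind
        · rw [Finset.union_comm, Sym2.eq_swap (a := q)]
      · obtain ⟨e, he, he'⟩ := Finset.not_subset.1 hFPQ
        obtain ⟨R, a, b, r, heR, hR⟩ := exists_path_component hFm hFac he
        have hdisj := (hPc.union hQc).disjoint_VsetE hR r heR he'
        have hd := Set.disjoint_left.1 hdisj
        rw [VsetE_union] at hd
        have ma := r.left_mem
        have mb := r.right_mem
        have nab := r.ne
        have hnew := hpair.insert_path (u := c) (v := p4) (x := p1) (y := q) (by simp)
          (by simp [Sym2.eq_swap]) hp1.1.symm hp4.2 r hdisj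
        refine hfull ((hPc.union hQc).union hR) hnew ?_ (u := c) (v := a) (y := p1) (by simp)
          (by simp [Sym2.eq_swap])
        have := linkShape_of_swap (p₁ := p1) (p₂ := q) (p₃ := c) (p₄ := p4) (x := a) (y := b)
          (c := c) (q := q) (by grind) (by grind) (by simp; grind) (by simp; grind)
        convert this using 1
        rw [Sym2.eq_swap (a := q) (b := p1), Finset.erase_singleton, Finset.erase_singleton,
          Finset.empty_union, Finset.empty_union, Sym2.eq_swap (a := c), Sym2.eq_swap (a := b) (b := q)]
        grind
  · obtain ⟨R, d₄, hR, hRc⟩ := exists_path_component_of_endpoint hFm hFac hp₄F hdeg₄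
    obtain ⟨e, he, he'⟩ := hR.left_mem
    have hPR := (hPc.disjoint_VsetE hRc hR he fun h => hp₄P ⟨e, h, he'⟩).symm
    have hQR := (hQc.disjoint_VsetE hRc hR he fun h => hp₄Q ⟨e, h, he'⟩).symm
    have hdPR := Set.disjoint_left.1 hPR
    have hdQR := Set.disjoint_left.1 hQR
    have m₄ := hR.left_mem
    have md₄ := hR.right_mem
    have n₄ := hR.ne
    refine hfull ((hPc.union hQc).union hRc) (.of_three_paths hc hq hQ hR hPQ hPR hQR) ?_
      (u := p4) (v := d₁) (y := q) (by simp [Sym2.eq_swap]) (by simp)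
    have := linkShape_of_swap (p₁ := p1) (p₂ := p2) (p₃ := p3) (p₄ := p4) (x := d₄) (y := d₁)
      (c := c) (q := q) hcq hcq' (by simp; grind) (by simp; grind)
    convert this using 1
    rw [Sym2.eq_swap (a := p1), Sym2.eq_swap (a := q)]
    grind
end

section
/- Let S be a 2-factor of G containing the path P = {(v1,v2), (v2,v3), (v3,v4)} with v1, v2, v3, v4 distinct, let C* be the cycle of S containing P, and let C** be a cycle of S distinct from C* (hence vertex-disjoint from C*). Let T be a path cover of G with (v1,v2), (v2,v3) ∈ T and V1(T) = V \ {v2}, and let T′ be a path cover of G with (v2,v3), (v3,v4) ∈ T′ and V1(T′) = V \ {v3}. Then there exist edges f ∈ C** \ T and f′ ∈ C** \ T′ such that (i) f and f′ have a common endpoint q, and (ii) both T ∪ {f} and T′ ∪ {f′} are path covers of G. -/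
variable {V : Type*} [Fintype V] [DecidableEq V]

section EdgeSets

variable {α : Type*} [DecidableEq α] {F C D S T : Finset (Sym2 α)}

lemma degE_insert_le (e : Sym2 α) (F : Finset (Sym2 α)) (v : α) :
    degE (insert e F) v ≤ degE F v + 1 := by
  unfold degE
  rw [Finset.filter_insert]
  split_ifs
  · exact Finset.card_insert_le _ _
  · omega

lemma degE_insert_of_notMem {e : Sym2 α} {v : α} (h : v ∉ e) (F : Finset (Sym2 α)) :
    degE (insert e F) v = degE F v := by
  unfold degE
  rw [Finset.filter_insert, if_neg h]

lemma exists_ne_of_two_le_degE {v : α} (h : 2 ≤ degE F v) (e : Sym2 α) :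
    ∃ e' ∈ F, v ∈ e' ∧ e' ≠ e := by
  obtain ⟨e', he', hne⟩ := Finset.exists_mem_ne (s := F.filter (fun e => v ∈ e)) h e
  rw [Finset.mem_filter] at he'
  exact ⟨e', he'.1, he'.2, hne⟩

lemma eq_of_degE_eq_one {v : α} (h : degE F v = 1) {e e' : Sym2 α} (he : e ∈ F) (he' : e' ∈ F)
    (hv : v ∈ e) (hv' : v ∈ e') : e = e' :=
  Finset.card_le_one.1 h.le e (Finset.mem_filter.2 ⟨he, hv⟩) e' (Finset.mem_filter.2 ⟨he', hv'⟩)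

/-- A cycle, written as a periodic sequence of vertices. -/
lemma IsCycleE.exists_periodic (h : IsCycleE C) :
    ∃ m : ℕ, 3 ≤ m ∧ ∃ g : ℕ → α, (∀ i j, g i = g j ↔ i % m = j % m) ∧
      ∀ e, e ∈ C ↔ ∃ i, e = s(g i, g (i + 1)) := by
  obtain ⟨m, hm, f, hf, rfl⟩ := h
  have hpos : 0 < m := by omega
  refine ⟨m, hm, fun i => f (i % m), fun i j => ⟨fun h => ?_, fun h => congrArg f h⟩,
    fun e => ?_⟩
  · exact hf _ (Nat.mod_lt _ hpos) _ (Nat.mod_lt _ hpos) h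
  · simp only [Finset.mem_image, Finset.mem_range]
    constructor
    · rintro ⟨i, hi, rfl⟩
      exact ⟨i, by rw [Nat.mod_eq_of_lt hi]⟩
    · rintro ⟨i, rfl⟩
      exact ⟨i % m, Nat.mod_lt _ hpos, by rw [Nat.mod_add_mod]⟩

lemma IsCycleE.two_le_degE (h : IsCycleE C) {v : α} (hv : v ∈ VsetE C) : 2 ≤ degE C v := by
  obtain ⟨m, hm, g, hg, hC⟩ := h.exists_periodic
  have hgv : ∃ i, g (i + 1) = v := by
    obtain ⟨e, he, hve⟩ := hv
    obtain ⟨i, rfl⟩ := (hC e).1 he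
    rcases Sym2.mem_iff.1 hve with rfl | rfl
    · refine ⟨i + (m - 1), (hg _ _).2 ?_⟩
      rw [show i + (m - 1) + 1 = i + m by omega, Nat.add_mod_right]
    · exact ⟨i, rfl⟩
  obtain ⟨i, rfl⟩ := hgv
  refine Finset.one_lt_card.2 ⟨s(g i, g (i + 1)), ?_, s(g (i + 1), g (i + 1 + 1)), ?_, ?_⟩
  · exact Finset.mem_filter.2 ⟨(hC _).2 ⟨i, rfl⟩, by simp⟩
  · exact Finset.mem_filter.2 ⟨(hC _).2 ⟨i + 1, rfl⟩, by simp⟩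
  · intro heq
    have hmem : g i ∈ s(g (i + 1), g (i + 1 + 1)) := heq ▸ Sym2.mem_mk_left _ _
    have hnot : ∀ k, 0 < k → k < 3 → g i ≠ g (i + k) := by
      intro k hk hk3 hik
      have hmod : i ≡ i + k [MOD m] := (hg _ _).1 hik
      have hdvd := (Nat.modEq_iff_dvd' (Nat.le_add_right i k)).1 hmod
      rw [Nat.add_sub_cancel_left] at hdvd
      exact absurd (Nat.le_of_dvd hk hdvd) (by omega)
    rcases Sym2.mem_iff.1 hmem with h1 | h2
    · exact hnot 1 (by omega) (by omega) h1
    · exact hnot 2 (by omega) (by omega) h2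

/-- Inside a `2`-matching, a cycle through a vertex carries every edge at that vertex. -/
lemma IsCycleE.mem_of_incident (hD : IsCycleE D) (hDS : D ⊆ S) (hS : ∀ v, degE S v ≤ 2)
    {v : α} (hv : v ∈ VsetE D) {e : Sym2 α} (he : e ∈ S) (hve : v ∈ e) : e ∈ D := by
  have heq := Finset.eq_of_subset_of_card_le
    (Finset.filter_subset_filter (fun e => v ∈ e) hDS) ((hS v).trans (hD.two_le_degE hv))
  have hmem : e ∈ D.filter (fun e => v ∈ e) := heq ▸ Finset.mem_filter.2 ⟨he, hve⟩
  exact (Finset.mem_filter.1 hmem).1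

lemma IsCycleE.subset_of_common_vertex (hC : IsCycleE C) (hD : IsCycleE D) (hCS : C ⊆ S)
    (hDS : D ⊆ S) (hS : ∀ v, degE S v ≤ 2) {v : α} (hvC : v ∈ VsetE C) (hvD : v ∈ VsetE D) :
    C ⊆ D := by
  obtain ⟨m, hm, g, hg, hCe⟩ := hC.exists_periodic
  have hstep : ∀ i, g i ∈ VsetE D → s(g i, g (i + 1)) ∈ D := fun i hi =>
    hD.mem_of_incident hDS hS hi (hCS ((hCe _).2 ⟨i, rfl⟩)) (Sym2.mem_mk_left _ _)
  have hstart : ∃ i, g i ∈ VsetE D := by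
    obtain ⟨e, he, hve⟩ := hvC
    obtain ⟨i, rfl⟩ := (hCe e).1 he
    rcases Sym2.mem_iff.1 hve with rfl | rfl
    exacts [⟨i, hvD⟩, ⟨i + 1, hvD⟩]
  obtain ⟨i, hi⟩ := hstart
  have hall : ∀ k, g (i + k) ∈ VsetE D := by
    intro k
    induction k with
    | zero => exact hi
    | succ k ih => exact ⟨_, hstep _ ih, Sym2.mem_mk_right _ _⟩
  intro e he
  obtain ⟨j, rfl⟩ := (hCe e).1 he
  refine hstep j ?_
  have hj : g (i + (j + i * (m - 1))) = g j := by
    refine (hg _ _).2 ?_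
    obtain ⟨n, rfl⟩ : ∃ n, m = n + 1 := ⟨m - 1, by omega⟩
    rw [show i + (j + i * (n + 1 - 1)) = j + (n + 1) * i by simp; ring, Nat.add_mul_mod_self_left]
  exact hj ▸ hall _

/-- In a `2`-matching, distinct cycles are vertex-disjoint. -/
lemma IsCycleE.disjoint_of_ne (hC : IsCycleE C) (hD : IsCycleE D) (hCS : C ⊆ S)
    (hDS : D ⊆ S) (hS : ∀ v, degE S v ≤ 2) (hne : C ≠ D) : Disjoint (VsetE C) (VsetE D) :=
  Set.disjoint_left.2 fun _ hvC hvD => hne <|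
    (hC.subset_of_common_vertex hD hCS hDS hS hvC hvD).antisymm
      (hD.subset_of_common_vertex hC hDS hCS hS hvD hvC)

/-- Two edges at a vertex of degree at most two exhaust its neighbours. -/
lemma eq_or_eq_of_degE_le_two {x p r a : α} (hx : degE T x ≤ 2) (hpr : p ≠ r)
    (hp : s(p, x) ∈ T) (hr : s(r, x) ∈ T) (ha : s(a, x) ∈ T) : a = p ∨ a = r := by
  by_contra! h
  have hsub : ({p, r, a} : Finset α).image (fun y => s(y, x)) ⊆ T.filter (fun e => x ∈ e) := by
    intro e he
    simp only [Finset.mem_image, Finset.mem_insert, Finset.mem_singleton] at he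
    obtain ⟨y, rfl | rfl | rfl, rfl⟩ := he <;> simp [*]
  have hcard := Finset.card_le_card hsub
  rw [Finset.card_image_of_injective _ fun y z hyz => Sym2.congr_left.1 hyz,
    Finset.card_eq_three.2 ⟨p, r, a, hpr, h.1.symm, h.2.symm, rfl⟩] at hcard
  exact absurd (hcard.trans hx) (by omega)

/-- In a path cover in which every vertex but `x` has degree one, an edge avoiding `x`, with an
end not adjacent to `x`, can be added. -/
lemma IsPathCoverE.insert_edge {x a b : α} (hT : IsPathCoverE T) (hx : V1E T = Set.univ \ {x})
    (hab : a ≠ b) (hax : a ≠ x) (hbx : b ≠ x) (hadj : s(a, x) ∉ T) :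
    IsPathCoverE (insert s(a, b) T) := by
  obtain ⟨⟨hsimple, hdeg⟩, hspan, hacyc⟩ := hT
  have hone : ∀ v, v ≠ x → degE T v = 1 := fun v hv => by
    have hmem : v ∈ V1E T := hx ▸ ⟨trivial, hv⟩
    exact hmem
  refine ⟨⟨?_, fun v => ?_⟩, ?_, ?_⟩
  · intro e he
    rcases Finset.mem_insert.1 he with rfl | he
    · simpa using hab
    · exact hsimple e he
  · by_cases hv : v = x
    · subst hv
      rw [degE_insert_of_notMem (by simp [hax.symm, hbx.symm])]
      exact hdeg v
    · exact (degE_insert_le _ _ _).trans (by rw [hone v hv])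
  · refine Set.eq_univ_of_forall fun v => ?_
    obtain ⟨e, he, hve⟩ : v ∈ VsetE T := hspan ▸ Set.mem_univ v
    exact ⟨e, Finset.mem_insert_of_mem he, hve⟩
  · intro C hCsub hC
    have hmemT : ∀ e ∈ C, e ≠ s(a, b) → e ∈ T := fun e he hne =>
      Finset.mem_of_mem_insert_of_ne (hCsub he) hne
    have hfC : s(a, b) ∈ C := by
      by_contra hfC
      exact hacyc C (fun e he => hmemT e he fun h => hfC (h ▸ he)) hC
    obtain ⟨e, heC, hae, hef⟩ := exists_ne_of_two_le_degE
      (hC.two_le_degE ⟨_, hfC, Sym2.mem_mk_left a b⟩) s(a, b)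
    obtain ⟨c, rfl⟩ := hae
    have hacT := hmemT _ heC hef
    have hac : a ≠ c := by simpa using hsimple _ hacT
    have hcb : c ≠ b := fun h => hef (h ▸ rfl)
    have hcx : c ≠ x := fun h => hadj (h ▸ hacT)
    obtain ⟨e', heC', hce', hne'⟩ := exists_ne_of_two_le_degE
      (hC.two_le_degE ⟨_, heC, Sym2.mem_mk_right a c⟩) s(a, c)
    have heT' : e' ∈ T := hmemT e' heC' fun h => by
      rcases Sym2.mem_iff.1 (h ▸ hce') with h | h
      exacts [hac h.symm, hcb h]
    exact hne' (eq_of_degE_eq_one (hone c hcx) heT' hacT hce' (Sym2.mem_mk_right a c))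

/-- Let all vertices but `x` have degree one in the path cover `T`, and let `p`, `r` be the
neighbours of `x`. Any cycle avoiding `p`, `x`, `r` has an edge at each of its vertices that can be
added to `T`. -/
lemma IsPathCoverE.exists_insert_of_cycle {x p r q : α} (hT : IsPathCoverE T)
    (hx : V1E T = Set.univ \ {x}) (hpr : p ≠ r) (hp : s(p, x) ∈ T) (hr : s(r, x) ∈ T)
    (hC : IsCycleE C) (hsimple : SimpleE C) (hpC : p ∉ VsetE C) (hxC : x ∉ VsetE C)
    (hrC : r ∉ VsetE C) (hq : q ∈ VsetE C) :
    ∃ f ∈ C, f ∉ T ∧ q ∈ f ∧ IsPathCoverE (insert f T) := by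
  have hne : ∀ {y z : α}, y ∈ VsetE C → z ∉ VsetE C → y ≠ z := fun hy hz h => hz (h ▸ hy)
  have hdeg : degE T q = 1 := by
    have hmem : q ∈ V1E T := hx ▸ ⟨trivial, hne hq hxC⟩
    exact hmem
  obtain ⟨f, hfC, hqf, hfT⟩ : ∃ f ∈ C, q ∈ f ∧ f ∉ T := by
    by_contra! h
    have hle : degE C q ≤ degE T q := Finset.card_le_card fun e he => by
      rw [Finset.mem_filter] at he ⊢
      exact ⟨h e he.1 he.2, he.2⟩
    have := hC.two_le_degE hq
    omega
  refine ⟨f, hfC, hfT, hqf, ?_⟩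
  obtain ⟨b, rfl⟩ := hqf
  have hb : b ∈ VsetE C := ⟨_, hfC, Sym2.mem_mk_right q b⟩
  refine hT.insert_edge hx (by simpa using hsimple _ hfC) (hne hq hxC) (hne hb hxC)
    fun hqx => ?_
  rcases eq_or_eq_of_degE_le_two (hT.1.2 x) hpr hp hr hqx with h | h
  exacts [hne hq hpC h, hne hq hrC h]

end EdgeSets

/-- Lemma 8 of the paper. -/
theorem stmt6 (S Cstar Cstar2 T T' : Finset (Sym2 V)) (v1 v2 v3 v4 : V)
    (hS : IsKFactor 2 S)
    (hdist : v1 ≠ v2 ∧ v1 ≠ v3 ∧ v1 ≠ v4 ∧ v2 ≠ v3 ∧ v2 ≠ v4 ∧ v3 ≠ v4)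
    (hCstar : IsCycleE Cstar) (hCstarS : Cstar ⊆ S)
    (hP : ({s(v1, v2), s(v2, v3), s(v3, v4)} : Finset (Sym2 V)) ⊆ Cstar)
    (hCstar2 : IsCycleE Cstar2) (hCstar2S : Cstar2 ⊆ S) (hne : Cstar2 ≠ Cstar)
    (hT : IsPathCoverE T) (hT12 : s(v1, v2) ∈ T) (hT23 : s(v2, v3) ∈ T)
    (hV1T : V1E T = Set.univ \ {v2})
    (hT' : IsPathCoverE T') (hT'23 : s(v2, v3) ∈ T') (hT'34 : s(v3, v4) ∈ T')
    (hV1T' : V1E T' = Set.univ \ {v3}) :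
    ∃ f ∈ Cstar2, f ∉ T ∧ ∃ f' ∈ Cstar2, f' ∉ T' ∧
      (∃ q : V, q ∈ f ∧ q ∈ f') ∧
      IsPathCoverE (insert f T) ∧ IsPathCoverE (insert f' T') := by
  obtain ⟨h12, h13, h14, h23, h24, h34⟩ := hdist
  have hdisj := hCstar.disjoint_of_ne hCstar2 hCstarS hCstar2S (fun v => (hS.2 v).le) hne.symm
  have havoid : ∀ e ∈ ({s(v1, v2), s(v2, v3), s(v3, v4)} : Finset (Sym2 V)), ∀ v ∈ e,
      v ∉ VsetE Cstar2 := fun e he v hv => Set.disjoint_left.1 hdisj ⟨e, hP he, hv⟩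
  have h1 : v1 ∉ VsetE Cstar2 := havoid s(v1, v2) (by simp) _ (by simp)
  have h2 : v2 ∉ VsetE Cstar2 := havoid s(v1, v2) (by simp) _ (by simp)
  have h3 : v3 ∉ VsetE Cstar2 := havoid s(v3, v4) (by simp) _ (by simp)
  have h4 : v4 ∉ VsetE Cstar2 := havoid s(v3, v4) (by simp) _ (by simp)
  have hsimple : SimpleE Cstar2 := fun e he => hS.1 e (hCstar2S he)
  obtain ⟨q, hq⟩ : (VsetE Cstar2).Nonempty := by
    obtain ⟨m, -, g, -, hg⟩ := hCstar2.exists_periodic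
    exact ⟨g 0, _, (hg _).2 ⟨0, rfl⟩, Sym2.mem_mk_left _ _⟩
  obtain ⟨f, hf, hfT, hqf, hcover⟩ := hT.exists_insert_of_cycle hV1T h13 hT12
    (Sym2.eq_swap ▸ hT23) hCstar2 hsimple h1 h2 h3 hq
  obtain ⟨f', hf', hfT', hqf', hcover'⟩ := hT'.exists_insert_of_cycle hV1T' h24 hT'23
    (Sym2.eq_swap ▸ hT'34) hCstar2 hsimple h2 h3 h4 hq
  exact ⟨f, hf, hfT, f', hf', hfT', ⟨q, hqf, hqf'⟩, hcover, hcover'⟩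
end
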